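/- Let q be a prime power, F_q the finite field with q elements, and d ≥ 2. Let b = bias(det_d) = |{A ∈ M_d(F_q) : det(A) = 0}|/q^{d²} − |{A ∈ M_d(F_q) : det(A) = y}|/q^{d²} for some fixed nonzero y ∈ F_q. Then every partition rank decomposition of the determinant d-linear form det_d over F_q has length r satisfying 2r ≥ (log₂(d) + 1)·⌈−log_q(b)⌉; in particular, prk(det_d)/⌈ark(det_d)⌉ ≥ (log₂(d)+1)/2. -/

import Mathlib

/-- A partition rank decomposition of the determinant `n`-linear form of length `r`:
subsets `∅ ≠ I i ≠ univ` of the `n` vector variables, multilinear forms `Q i` in the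
variables in `I i` and `R i` in the complementary variables, such that
`det(x₁,...,xₙ) = Σ i, Q i * R i`. -/
def IsPartitionDecompOfDet (F : Type*) [Field F] (n r : ℕ)
    (I : Fin r → Finset (Fin n))
    (Q : ∀ i, MultilinearMap F (fun _ : {j : Fin n // j ∈ I i} => (Fin n → F)) F)
    (R : ∀ i, MultilinearMap F (fun _ : {j : Fin n // j ∉ I i} => (Fin n → F)) F) : Prop :=
  (∀ i, (I i).Nonempty ∧ I i ≠ Finset.univ) ∧
    ∀ x : Fin n → (Fin n → F),
      (Matrix.of x).det = ∑ i, Q i (fun j => x j.1) * R i (fun j => x j.1)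

/-- The bias of the determinant of `d × d` matrices over a finite field `F`:
`Pr[det = 0] − Pr[det = y]` for a fixed nonzero `y`. -/
noncomputable def detBias (F : Type*) [Field F] [Fintype F] (d : ℕ) (y : F) : ℝ :=
  (Nat.card {A : Matrix (Fin d) (Fin d) F // A.det = 0} : ℝ) /
      (Fintype.card F : ℝ) ^ (d ^ 2) -
    (Nat.card {A : Matrix (Fin d) (Fin d) F // A.det = y} : ℝ) /
      (Fintype.card F : ℝ) ^ (d ^ 2)

section LinearIndepOn

variable {F V ι : Type*} [Field F] [AddCommGroup V] [Module F V] [FiniteDimensional F V]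
  [DecidableEq ι]

/-- A linearly independent family can be extended by a vector from any subspace of
larger dimension. -/
theorem exists_mem_linearIndepOn_update {x : ι → V} {A : Finset ι} {j : ι} (hj : j ∉ A)
    (hx : LinearIndepOn F x (A : Set ι)) (W : Submodule F V)
    (hW : A.card < Module.finrank F W) :
    ∃ v ∈ W, LinearIndepOn F (Function.update x j v) (insert j A : Finset ι) := by
  classical
  obtain ⟨v, hvW, hv⟩ : ∃ v ∈ W, v ∉ Submodule.span F (x '' (A : Set ι)) := by
    by_contra! h
    have h1 : Module.finrank F W ≤ Module.finrank F (Submodule.span F (x '' (A : Set ι))) :=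
      Submodule.finrank_mono h
    have h2 := finrank_span_finset_le_card (R := F) (A.image x)
    rw [Finset.coe_image, Set.finrank] at h2
    have h3 := Finset.card_image_le (s := A) (f := x)
    omega
  have hEq : Set.EqOn x (Function.update x j v) (A : Set ι) := fun i hi =>
    (Function.update_of_ne (fun h => hj (by simpa [h] using hi)) _ _).symm
  refine ⟨v, hvW, ?_⟩
  rw [Finset.coe_insert, linearIndepOn_insert (by simpa using hj), Function.update_self,
    ← Set.EqOn.image_eq hEq]
  exact ⟨hx.congr hEq, hv⟩

theorem exists_linearIndepOn_union (A B : Finset ι) (hAB : Disjoint A B)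
    (hcard : (A ∪ B).card ≤ Module.finrank F V) {x : ι → V}
    (hx : LinearIndepOn F x (A : Set ι)) :
    ∃ z : ι → V, (∀ i ∉ B, z i = x i) ∧ LinearIndepOn F z (A ∪ B : Finset ι) := by
  induction B using Finset.induction_on with
  | empty => exact ⟨x, by simp, by simpa using hx⟩
  | insert j B hj ih =>
    rw [Finset.disjoint_insert_right] at hAB
    have hjU : j ∉ A ∪ B := by simp [hj, hAB.1]
    rw [Finset.union_insert, Finset.card_insert_of_notMem hjU] at hcard
    obtain ⟨z, hz, hzi⟩ := ih hAB.2 (by omega)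
    obtain ⟨v, -, hv⟩ := exists_mem_linearIndepOn_update hjU hzi ⊤ (by rw [finrank_top]; omega)
    refine ⟨Function.update z j v, fun i hi => ?_, by rwa [Finset.union_insert]⟩
    rw [Finset.mem_insert, not_or] at hi
    rw [Function.update_of_ne hi.1, hz i hi.2]

omit [DecidableEq ι] in
theorem finrank_le_card_add_finrank_ker_pi {κ : Type*} [Fintype κ] (L : κ → V →ₗ[F] F) :
    Module.finrank F V ≤ Fintype.card κ + Module.finrank F (LinearMap.ker (LinearMap.pi L)) := by
  have h := LinearMap.finrank_range_add_finrank_ker (LinearMap.pi L)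
  have h2 := Submodule.finrank_le (LinearMap.range (LinearMap.pi L))
  rw [Module.finrank_fintype_fun_eq_card] at h2
  omega

end LinearIndepOn

theorem MultilinearMap.exists_linearMap_restrict_update {F V ι : Type*} [Field F]
    [AddCommGroup V] [Module F V] [DecidableEq ι] (p : ι → Prop)
    (Q : MultilinearMap F (fun _ : {i // p i} => V) F) {j : ι} (hj : p j) (x : ι → V) :
    ∃ L : V →ₗ[F] F, ∀ v, L v = Q (fun i => Function.update x j v i.1) := by
  classical
  refine ⟨Q.toLinearMap (fun i => x i.1) ⟨j, hj⟩, fun v => ?_⟩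
  rw [MultilinearMap.toLinearMap_apply]
  congr 1
  funext i
  by_cases h : i = ⟨j, hj⟩
  · subst h; simp
  · rw [Function.update_of_ne h, Function.update_of_ne (fun h' => h (Subtype.ext h'))]

theorem two_mul_le_two_pow_of_half_lt {s t : ℕ} (h : s + 2 ≤ 2 * t) : 2 * s ≤ 2 ^ t := by
  obtain ⟨n, rfl⟩ : ∃ n, t = n + 1 := ⟨t - 1, by omega⟩
  have : n + 1 ≤ 2 ^ n := Nat.lt_two_pow_self
  have h3 : 2 * n ≤ 2 ^ n := by
    clear h this
    induction n with
    | zero => simp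
    | succ n ih =>
      have : n + 1 ≤ 2 ^ n := Nat.lt_two_pow_self
      rw [pow_succ]; omega
  rw [pow_succ]; omega

section PartitionRank

variable {F V ι κ : Type*} [Field F] [AddCommGroup V] [Module F V] [FiniteDimensional F V]
  [Fintype ι] [DecidableEq ι]

/-- Fix the vectors outside `S` to be linearly independent. If a sum of products over `T`,
each of which splits `S` nontrivially, does not vanish on linearly independent families, then
`T` has at least `1 + log₂ |S|` elements. -/
theorem two_mul_card_le_two_pow_card (hV : Fintype.card ι = Module.finrank F V)
    (I : κ → Finset ι)
    (Q : ∀ t, MultilinearMap F (fun _ : {j : ι // j ∈ I t} => V) F)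
    (R : ∀ t, MultilinearMap F (fun _ : {j : ι // j ∉ I t} => V) F)
    (S : Finset ι) (T : Finset κ) (x : ι → V)
    (hx : LinearIndepOn F x (Sᶜ : Finset ι))
    (hT : ∀ t ∈ T, (S ∩ I t).Nonempty ∧ (S \ I t).Nonempty)
    (hne : ∀ z : ι → V, (∀ i ∉ S, z i = x i) → LinearIndependent F z →
      ∑ t ∈ T, Q t (fun j => z j.1) * R t (fun j => z j.1) ≠ 0) :
    2 * S.card ≤ 2 ^ T.card := by
  classical
  induction hs : S.card using Nat.strong_induction_on generalizing S T x with
  | _ s ih =>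
  subst hs
  have hTne : T.Nonempty := by
    by_contra h
    rw [Finset.not_nonempty_iff_eq_empty] at h
    subst h
    obtain ⟨z, hz, hzi⟩ := exists_linearIndepOn_union Sᶜ S disjoint_compl_left
      (by rw [← hV]; exact Finset.card_le_univ _) hx
    refine hne z hz ?_ (by simp)
    simpa [linearIndepOn_univ_iff, Finset.union_comm] using hzi
  let C : Finset (Finset ι) := T.image (fun t => S ∩ I t) ∪ T.image (fun t => S \ I t)
  have hC1 : ∀ t ∈ T, S ∩ I t ∈ C := fun t ht =>
    Finset.mem_union_left _ (Finset.mem_image_of_mem _ ht)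
  have hC2 : ∀ t ∈ T, S \ I t ∈ C := fun t ht =>
    Finset.mem_union_right _ (Finset.mem_image_of_mem _ ht)
  obtain ⟨t₀, ht₀⟩ := hTne
  obtain ⟨J, hJC, hJmin⟩ := Finset.exists_min_image C Finset.card ⟨_, hC1 t₀ ht₀⟩
  have hJ : J.Nonempty ∧ J ⊆ S ∧ ∃ t ∈ T, S ∩ I t = J ∨ S \ I t = J := by
    rcases Finset.mem_union.1 hJC with h | h <;> obtain ⟨t, ht, rfl⟩ := Finset.mem_image.1 h
    · exact ⟨(hT t ht).1, Finset.inter_subset_left, t, ht, Or.inl rfl⟩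
    · exact ⟨(hT t ht).2, Finset.sdiff_subset, t, ht, Or.inr rfl⟩
  obtain ⟨⟨j, hj⟩, hJS, t₁, ht₁, ht₁J⟩ := hJ
  have hJcard : 2 * J.card ≤ S.card := by
    have h1 := hJmin _ (hC1 t₀ ht₀)
    have h2 := hJmin _ (hC2 t₀ ht₀)
    have h3 := Finset.card_inter_add_card_sdiff S (I t₀)
    omega
  have hJpos : 0 < J.card := Finset.card_pos.2 ⟨j, hj⟩
  have hSle : S.card ≤ Module.finrank F V := hV ▸ Finset.card_le_univ S
  let K : Finset κ := T.filter (fun t => S ∩ I t = J ∨ S \ I t = J)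
  have hKpos : 0 < K.card := Finset.card_pos.2 ⟨t₁, Finset.mem_filter.2 ⟨ht₁, ht₁J⟩⟩
  have hKT : K ⊆ T := Finset.filter_subset _ _
  rcases Nat.lt_or_ge (S.card - J.card) K.card with hK | hK
  · exact two_mul_le_two_pow_of_half_lt (by have := Finset.card_le_card hKT; omega)
  -- Extend to all of `J` but `j`, then choose the vector at `j` to kill every term of `K`.
  have hcc : Sᶜ.card = Module.finrank F V - S.card := by rw [Finset.card_compl, hV]
  have hdis : Disjoint Sᶜ (J.erase j) :=
    (disjoint_compl_left (a := S)).mono_right ((Finset.erase_subset _ _).trans hJS)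
  have hcard : (Sᶜ ∪ J.erase j).card = Module.finrank F V - S.card + (J.card - 1) := by
    rw [Finset.card_union_of_disjoint hdis, hcc, Finset.card_erase_of_mem hj]
  obtain ⟨z, hz, hzi⟩ := exists_linearIndepOn_union Sᶜ (J.erase j) hdis (by omega) hx
  have hL : ∀ t : K, ∃ L : V →ₗ[F] F, ∀ v, L v = 0 → ∀ w : ι → V,
      (∀ i ∉ S \ J, w i = Function.update z j v i) →
      Q t (fun j => w j.1) * R t (fun j => w j.1) = 0 := by
    rintro ⟨t, ht⟩
    have hK' : ∀ p : ι → Prop, (∀ i, i ∈ S → p i → i ∈ J) → ∀ i, p i → i ∉ S \ J := by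
      intro p hp i hi hiS
      rw [Finset.mem_sdiff] at hiS
      exact hiS.2 (hp i hiS.1 hi)
    rcases (Finset.mem_filter.1 ht).2 with h | h
    · have hjI : j ∈ I t := (Finset.mem_inter.1 (h ▸ hj)).2
      obtain ⟨L, hL⟩ := (Q t).exists_linearMap_restrict_update _ hjI z
      refine ⟨L, fun v hv w hw => mul_eq_zero_of_left ?_ _⟩
      rw [← hv, hL]
      congr 1
      funext i
      exact hw _ (hK' (· ∈ I t) (fun i h1 h2 => h ▸ Finset.mem_inter.2 ⟨h1, h2⟩) _ i.2)
    · have hjI : j ∉ I t := (Finset.mem_sdiff.1 (h ▸ hj)).2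
      obtain ⟨L, hL⟩ := (R t).exists_linearMap_restrict_update _ hjI z
      refine ⟨L, fun v hv w hw => mul_eq_zero_of_right _ ?_⟩
      rw [← hv, hL]
      congr 1
      funext i
      exact hw _ (hK' (· ∉ I t) (fun i h1 h2 => h ▸ Finset.mem_sdiff.2 ⟨h1, h2⟩) _ i.2)
  choose L hL using hL
  have hker := finrank_le_card_add_finrank_ker_pi L
  rw [Fintype.card_coe] at hker
  obtain ⟨v, hvW, hv⟩ := exists_mem_linearIndepOn_update
    (j := j) (by simp [hJS hj]) hzi (LinearMap.ker (LinearMap.pi L)) (by omega)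
  have hunion : insert j (Sᶜ ∪ J.erase j) = (S \ J)ᶜ := by
    rw [← Finset.union_insert, Finset.insert_erase hj]
    ext i
    simp only [Finset.mem_union, Finset.mem_compl, Finset.mem_sdiff]
    tauto
  rw [hunion] at hv
  have hkill : ∀ t ∈ K, ∀ w : ι → V, (∀ i ∉ S \ J, w i = Function.update z j v i) →
      Q t (fun j => w j.1) * R t (fun j => w j.1) = 0 := fun t ht =>
    hL ⟨t, ht⟩ v (by simpa using congrFun (LinearMap.mem_ker.1 hvW) ⟨t, ht⟩)
  have hSJ : (S \ J).card = S.card - J.card := Finset.card_sdiff_of_subset hJS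
  have hTK : (T \ K).card = T.card - K.card := Finset.card_sdiff_of_subset hKT
  have hsplit : ∀ A ∈ C, A ≠ J → (A \ J).Nonempty := by
    intro A hA hne
    rw [Finset.nonempty_iff_ne_empty, Ne, Finset.sdiff_eq_empty_iff_subset]
    exact fun h => hne (Finset.eq_of_subset_of_card_le h (hJmin A hA))
  have key := ih _ (by omega) (S \ J) (T \ K) (Function.update z j v) hv
    (fun t ht => by
      rw [Finset.mem_sdiff] at ht
      have htK : ¬ (S ∩ I t = J ∨ S \ I t = J) := fun h =>
        ht.2 (Finset.mem_filter.2 ⟨ht.1, h⟩)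
      rw [not_or] at htK
      have h1 := hsplit _ (hC1 t ht.1) htK.1
      have h2 := hsplit _ (hC2 t ht.1) htK.2
      exact ⟨h1.mono (by intro i; simp only [Finset.mem_inter, Finset.mem_sdiff]; tauto),
        h2.mono (by intro i; simp only [Finset.mem_sdiff]; tauto)⟩)
    (fun w hw hwi => by
      have hwS : ∀ i ∉ S, w i = x i := fun i hi => by
        rw [hw i (fun h => hi (Finset.sdiff_subset h)),
          Function.update_of_ne (fun h : i = j => hi (h ▸ hJS hj)),
          hz i (fun h => hi (hJS (Finset.mem_of_mem_erase h)))]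
      have := hne w hwS hwi
      rwa [← Finset.sum_sdiff hKT, Finset.sum_eq_zero (s := K) (fun t ht => hkill t ht w hw),
        add_zero] at this) rfl
  calc 2 * S.card ≤ 2 * (2 * (S \ J).card) := by omega
    _ ≤ 2 * 2 ^ (T \ K).card := by omega
    _ = 2 ^ ((T \ K).card + 1) := by rw [pow_succ, mul_comm]
    _ ≤ 2 ^ T.card := Nat.pow_le_pow_right (by norm_num)
      (by have := Finset.card_le_card hKT; omega)

end PartitionRank

theorem IsPartitionDecompOfDet.two_mul_le_two_pow {F : Type*} [Field F] {d r : ℕ}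
    {I : Fin r → Finset (Fin d)}
    {Q : ∀ i, MultilinearMap F (fun _ : {j : Fin d // j ∈ I i} => (Fin d → F)) F}
    {R : ∀ i, MultilinearMap F (fun _ : {j : Fin d // j ∉ I i} => (Fin d → F)) F}
    (h : IsPartitionDecompOfDet F d r I Q R) : 2 * d ≤ 2 ^ r := by
  have := two_mul_card_le_two_pow_card (F := F) (V := Fin d → F) (by simp) I Q R
    Finset.univ Finset.univ 0 (by simp)
    (fun t _ => ⟨by simpa using (h.1 t).1, by
      rw [← Finset.compl_eq_univ_sdiff, Finset.nonempty_iff_ne_empty, Ne,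
        Finset.compl_eq_empty_iff]
      exact (h.1 t).2⟩)
    (fun z _ hz => by
      rw [← h.2 z]
      exact ((Matrix.isUnit_iff_isUnit_det _).1
        (Matrix.linearIndependent_rows_iff_isUnit.1 hz)).ne_zero)
  simpa using this

section Bias

open Finset

variable {F : Type*} [Field F] [Fintype F] [DecidableEq F]

omit [Fintype F] in
theorem LinearMap.sum_indicator_sub_ge {V : Type*} [AddCommGroup V] [Module F V] [Fintype V]
    (L : V →ₗ[F] F) {y : F} (hy : y ≠ 0) [Decidable (L = 0)] :
    (if L = 0 then (Fintype.card V : ℝ) else 0) ≤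
      ∑ u, ((if L u = 0 then (1 : ℝ) else 0) - if L u = y then 1 else 0) := by
  split_ifs with h
  · simp [h, hy.symm]
  · rw [sum_sub_distrib, sub_nonneg]
    by_cases hu : ∃ u, L u = y
    · obtain ⟨u, rfl⟩ := hu
      rw [← Equiv.sum_comp (Equiv.subRight u) (fun v => if L v = 0 then (1 : ℝ) else 0)]
      simp [sub_eq_zero]
    · push Not at hu
      simp [hu]

/-- For every choice of `n` rows, at least `q ^ n` choices of a further row leave the
determinant identically zero in the last one. -/
theorem card_pow_le_card_det_eq_zero (n : ℕ) (R : Fin n → Fin (n + 2) → F) :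
    (Fintype.card F) ^ n ≤ Fintype.card {v : Fin (n + 2) → F //
      ∀ u, Matrix.detRowAlternating (Fin.cons u (Fin.cons v R) : Fin (n + 2) → Fin (n + 2) → F)
        = 0} := by
  have hdep : ∀ u v : Fin (n + 2) → F, ¬ LinearIndependent F (Fin.cons v R : Fin (n + 1) → _) →
      Matrix.detRowAlternating (Fin.cons u (Fin.cons v R) : Fin (n + 2) → Fin (n + 2) → F) = 0 :=
    fun u v h => AlternatingMap.map_linearDependent _ _
      (fun h' => h (linearIndependent_finCons.1 h').1)
  by_cases hR : LinearIndependent F R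
  · have hcard : Fintype.card F ^ n = Nat.card (Submodule.span F (Set.range R)) := by
      rw [Module.natCard_eq_pow_finrank (K := F), finrank_span_eq_card hR, Fintype.card_fin,
        Nat.card_eq_fintype_card]
    rw [hcard, ← Nat.card_eq_fintype_card]
    exact Nat.card_le_card_of_injective
      (fun v : Submodule.span F (Set.range R) =>
        (⟨v.1, fun u => hdep u v.1 (fun h => (linearIndependent_finCons.1 h).2 v.2)⟩ :
          {v : Fin (n + 2) → F // ∀ u, Matrix.detRowAlternating
            (Fin.cons u (Fin.cons v R) : Fin (n + 2) → Fin (n + 2) → F) = 0}))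
      (fun v w h => Subtype.ext (Subtype.mk.inj h))
  · have hall : ∀ v u, Matrix.detRowAlternating
        (Fin.cons u (Fin.cons v R) : Fin (n + 2) → Fin (n + 2) → F) = 0 :=
      fun v u => hdep u v (fun h => hR (linearIndependent_finCons.1 h).1)
    rw [Fintype.card_congr (Equiv.subtypeUnivEquiv hall), Fintype.card_fun, Fintype.card_fin]
    exact Nat.pow_le_pow_right Fintype.card_pos (by omega)

theorem card_pow_le_card_det_sub_card_det (n : ℕ) {y : F} (hy : y ≠ 0) :
    (Fintype.card F : ℝ) ^ ((n + 2) * n + n + (n + 2)) ≤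
      (Nat.card {A : Matrix (Fin (n + 2)) (Fin (n + 2)) F // A.det = 0} : ℝ) -
        Nat.card {A : Matrix (Fin (n + 2)) (Fin (n + 2)) F // A.det = y} := by
  classical
  let V := Fin (n + 2) → F
  let D : (Fin (n + 2) → V) → F := Matrix.detRowAlternating
  let w : F → ℝ := fun a => (if a = 0 then 1 else 0) - if a = y then 1 else 0
  have hsum : (Nat.card {A : Matrix (Fin (n + 2)) (Fin (n + 2)) F // A.det = 0} : ℝ) -
      Nat.card {A : Matrix (Fin (n + 2)) (Fin (n + 2)) F // A.det = y} =
      ∑ R : Fin n → V, ∑ v : V, ∑ u : V,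
        w (D (Fin.cons u (Fin.cons v R : Fin (n + 1) → V))) := by
    have h1 : ∀ a : F, (Nat.card {A : Matrix (Fin (n + 2)) (Fin (n + 2)) F // A.det = a} : ℝ) =
        ∑ A : Fin (n + 2) → V, if D A = a then 1 else 0 := by
      intro a
      rw [Nat.card_eq_fintype_card, Fintype.card_subtype, sum_boole]
      rfl
    rw [h1, h1, ← sum_sub_distrib,
      ← Equiv.sum_comp (Fin.consEquiv (fun _ : Fin (n + 2) => V)), Fintype.sum_prod_type_right,
      ← Equiv.sum_comp (Fin.consEquiv (fun _ : Fin (n + 1) => V)), Fintype.sum_prod_type_right]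
    rfl
  have hrow : ∀ R : Fin n → V, ∀ v : V,
      (if ∀ u, D (Fin.cons u (Fin.cons v R : Fin (n + 1) → V)) = 0
        then (Fintype.card F : ℝ) ^ (n + 2) else 0) ≤
      ∑ u : V, w (D (Fin.cons u (Fin.cons v R : Fin (n + 1) → V))) := by
    intro R v
    let L : V →ₗ[F] F :=
      (Matrix.detRowAlternating (n := Fin (n + 2)) (R := F)).toMultilinearMap.toLinearMap
        (Fin.cons 0 (Fin.cons v R : Fin (n + 1) → V)) 0
    have hL : ∀ u, L u = D (Fin.cons u (Fin.cons v R : Fin (n + 1) → V)) := fun u => by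
      simp only [L, MultilinearMap.toLinearMap_apply, Fin.update_cons_zero]
      rfl
    have := L.sum_indicator_sub_ge hy
    simp only [LinearMap.ext_iff, hL, LinearMap.zero_apply, V, Fintype.card_fun,
      Fintype.card_fin, Nat.cast_pow] at this
    exact this
  rw [hsum]
  calc (Fintype.card F : ℝ) ^ ((n + 2) * n + n + (n + 2))
      = ∑ _R : Fin n → V, (Fintype.card F : ℝ) ^ n * (Fintype.card F : ℝ) ^ (n + 2) := by
        simp only [sum_const, card_univ, V, Fintype.card_fun, Fintype.card_fin, nsmul_eq_mul]
        push_cast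
        ring
    _ ≤ _ := by
      refine sum_le_sum fun R _ => le_trans ?_ (sum_le_sum fun v _ => hrow R v)
      rw [← sum_filter, sum_const, nsmul_eq_mul, ← Fintype.card_subtype]
      gcongr
      exact_mod_cast card_pow_le_card_det_eq_zero n R

omit [DecidableEq F] in
theorem card_pow_neg_two_le_detBias {d : ℕ} (hd : 2 ≤ d) {y : F} (hy : y ≠ 0) :
    (Fintype.card F : ℝ) ^ (-2 : ℝ) ≤ detBias F d y := by
  classical
  obtain ⟨n, rfl⟩ : ∃ n, d = n + 2 := ⟨d - 2, by omega⟩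
  have hq : (0 : ℝ) < Fintype.card F := by exact_mod_cast Fintype.card_pos
  rw [detBias, ← sub_div, le_div_iff₀ (by positivity), ← Real.rpow_natCast, ← Real.rpow_add hq]
  refine le_trans (le_of_eq ?_) (card_pow_le_card_det_sub_card_det n hy)
  rw [← Real.rpow_natCast]
  congr 1
  push_cast
  ring

end Bias

theorem prk_vs_ark_separation {F : Type*} [Field F] [Fintype F] (d : ℕ) (hd : 2 ≤ d)
    (y : F) (hy : y ≠ 0) (r : ℕ)
    (I : Fin r → Finset (Fin d))
    (Q : ∀ i, MultilinearMap F (fun _ : {j : Fin d // j ∈ I i} => (Fin d → F)) F)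
    (R : ∀ i, MultilinearMap F (fun _ : {j : Fin d // j ∉ I i} => (Fin d → F)) F)
    (hdecomp : IsPartitionDecompOfDet F d r I Q R) :
    (Real.logb 2 d + 1) *
        (⌈-Real.logb (Fintype.card F) (detBias F d y)⌉ : ℝ) ≤ 2 * (r : ℝ) := by
  have hq : (1 : ℝ) < Fintype.card F := by exact_mod_cast Fintype.one_lt_card
  have hd1 : (1 : ℝ) ≤ d := by exact_mod_cast (by omega : 1 ≤ d)
  have hbias := card_pow_neg_two_le_detBias hd hy
  have hbpos : 0 < detBias F d y := (Real.rpow_pos_of_pos (by linarith) _).trans_le hbias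
  have hceil : (⌈-Real.logb (Fintype.card F) (detBias F d y)⌉ : ℝ) ≤ 2 := by
    have : ⌈-Real.logb (Fintype.card F) (detBias F d y)⌉ ≤ 2 := by
      rw [Int.ceil_le]
      have := (Real.le_logb_iff_rpow_le hq hbpos).2 hbias
      push_cast
      linarith
    exact_mod_cast this
  have hrank : Real.logb 2 d + 1 ≤ r := by
    have h : (2 : ℝ) * d ≤ 2 ^ r := by exact_mod_cast hdecomp.two_mul_le_two_pow
    rw [← Real.rpow_natCast, ← Real.logb_le_iff_le_rpow (by norm_num) (by positivity),
      Real.logb_mul (by norm_num) (by positivity), Real.logb_self_eq_one (by norm_num)] at h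
    linarith
  have hlog : 0 ≤ Real.logb 2 d := Real.logb_nonneg (by norm_num) hd1
  nlinarith
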